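/- Let Ω ⊆ ℝ³ be a bounded open set with smooth boundary such that Ω and ℍ¹ ∖ closure(Ω) satisfy the uniform exterior ball property. Suppose for every ξ ∈ Ω there is a regular part H_ξ of the Green's function of Ω at ξ with H_ξ(ξ) > 0, and set r_Ω(ξ) = 1/√(8π H_ξ(ξ)). Let ξ₀ ∈ Ω be a harmonic center of Ω, i.e. r_Ω(ξ₀) = max_{ξ∈Ω} r_Ω(ξ). Then λ₁(Ω) ≤ C_Ω(ξ₀) · l₁₁² / (max_{ξ∈Ω} r_Ω(ξ))², where C_Ω(ξ₀) = 16√2 · α_Ω(ξ₀)⁶ · √(3/(2π)), α_Ω(ξ₀) = (sup_{η∈∂Ω} d(ξ₀,η))/(inf_{η∈∂Ω} d(ξ₀,η)), and l₁₁ is the smallest strictly positive zero of the Bessel function J₁. -/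

import Mathlib

open MeasureTheory Real Set

noncomputable section

/-- The underlying space of the Heisenberg group ℍ¹: ℝ³ with coordinates (x, y, t). -/
abbrev H1 : Type := ℝ × ℝ × ℝ

/-- The Koranyi norm ρ(x,y,t) = ((x²+y²)² + t²)^{1/4}. -/
def ρH (η : H1) : ℝ := ((η.1 ^ 2 + η.2.1 ^ 2) ^ 2 + η.2.2 ^ 2) ^ ((1 : ℝ) / 4)

/-- The Heisenberg group law: η∘ξ = (x+x₀, y+y₀, t+t₀+2(x₀y − x y₀)). -/
def hmul (η ξ : H1) : H1 :=
  (η.1 + ξ.1, η.2.1 + ξ.2.1, η.2.2 + ξ.2.2 + 2 * (ξ.1 * η.2.1 - η.1 * ξ.2.1))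

/-- The Heisenberg group inverse: ξ⁻¹ = (−x₀,−y₀,−t₀). -/
def hinv (ξ : H1) : H1 := (-ξ.1, -ξ.2.1, -ξ.2.2)

/-- The Koranyi distance d(ξ,η) = ρ(ξ⁻¹∘η). -/
def kd (ξ η : H1) : ℝ := ρH (hmul (hinv ξ) η)

/-- The Koranyi ball B(ξ,r) = {η : d(ξ,η) < r}. -/
def kball (ξ : H1) (r : ℝ) : Set H1 := {η | kd ξ η < r}

/-- Horizontal derivative Xu = ∂u/∂x + 2y·∂u/∂t, as the derivative along (1,0,2y). -/
def Xd (u : H1 → ℝ) (η : H1) : ℝ := fderiv ℝ u η (1, 0, 2 * η.2.1)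

/-- Horizontal derivative Yu = ∂u/∂y − 2x·∂u/∂t, as the derivative along (0,1,−2x). -/
def Yd (u : H1 → ℝ) (η : H1) : ℝ := fderiv ℝ u η (0, 1, -2 * η.1)

/-- The Kohn-Laplacian Δ_ℍ u = X(Xu) + Y(Yu). -/
def kohn (u : H1 → ℝ) (η : H1) : ℝ := Xd (Xd u) η + Yd (Yd u) η

/-- The fundamental solution with pole ξ: Γ_ξ(η) = 1/(8π d(ξ,η)²). -/
def Γξ (ξ η : H1) : ℝ := 1 / (8 * π * kd ξ η ^ 2)

/-- A set A satisfies the uniform exterior ball property if there exists r₀ > 0 such that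
for every ζ ∈ ∂A and every r ∈ (0,r₀] there exists η with B(η,r) ∩ A = ∅ and ζ ∈ ∂B(η,r). -/
def uebp (A : Set H1) : Prop :=
  ∃ r₀ > (0 : ℝ), ∀ ζ ∈ frontier A, ∀ r : ℝ, 0 < r → r ≤ r₀ →
    ∃ η : H1, kball η r ∩ A = ∅ ∧ ζ ∈ frontier (kball η r)

/-- Ω has C¹ boundary: it is the sublevel set of a C¹ defining function with
nonvanishing gradient on the boundary. -/
def c1Bdry (Ω : Set H1) : Prop :=
  ∃ f : H1 → ℝ, ContDiff ℝ 1 f ∧ Ω = {x | f x < 0} ∧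
    frontier Ω = {x | f x = 0} ∧ ∀ x ∈ frontier Ω, fderiv ℝ f x ≠ 0

/-- Ω has smooth boundary: it is the sublevel set of a smooth defining function with
nonvanishing gradient on the boundary. -/
def smoothBdry (Ω : Set H1) : Prop :=
  ∃ f : H1 → ℝ, ContDiff ℝ (⊤ : ℕ∞) f ∧ Ω = {x | f x < 0} ∧
    frontier Ω = {x | f x = 0} ∧ ∀ x ∈ frontier Ω, fderiv ℝ f x ≠ 0

/-- The horizontal perimeter of Ω:
P_ℍ(Ω) = sup { ∫_Ω (Xa + Yb) : a,b of class C¹ with a²+b² ≤ 1 }. -/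
def horizPerim (Ω : Set H1) : ℝ :=
  sSup { p : ℝ | ∃ a b : H1 → ℝ, ContDiff ℝ 1 a ∧ ContDiff ℝ 1 b ∧
    (∀ η, a η ^ 2 + b η ^ 2 ≤ 1) ∧ p = ∫ η in Ω, (Xd a η + Yd b η) }

/-- The first Dirichlet eigenvalue of the Kohn-Laplacian on Ω, via the Rayleigh quotient. -/
def lam1 (Ω : Set H1) : ℝ :=
  sInf { q : ℝ | ∃ v : H1 → ℝ, ContDiff ℝ (⊤ : ℕ∞) v ∧ HasCompactSupport v ∧ tsupport v ⊆ Ω ∧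
    v ≠ 0 ∧ q = (∫ η in Ω, ((Xd v η) ^ 2 + (Yd v η) ^ 2)) / (∫ η in Ω, (v η) ^ 2) }

/-- The Bessel function of the first kind of order 1,
J₁(l) = (l/2)·Σ_{k=0}^∞ ((−1)^k/(k!·(k+1)!))·(l/2)^{2k}. -/
def J1 (l : ℝ) : ℝ :=
  (l / 2) * ∑' k : ℕ,
    ((-1 : ℝ) ^ k / ((Nat.factorial k : ℝ) * (Nat.factorial (k + 1) : ℝ))) * (l / 2) ^ (2 * k)

/-- The fourth power of the Koranyi distance, a polynomial in the coordinates. -/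
def kdPow (ξ η : H1) : ℝ :=
  ((η.1 - ξ.1) ^ 2 + (η.2.1 - ξ.2.1) ^ 2) ^ 2 +
    (η.2.2 - ξ.2.2 + 2 * (ξ.1 * η.2.1 - η.1 * ξ.2.1)) ^ 2

lemma kdPow_nonneg (ξ η : H1) : 0 ≤ kdPow ξ η := by
  unfold kdPow; positivity

lemma kd_eq_rpow (ξ η : H1) : kd ξ η = kdPow ξ η ^ ((1 : ℝ) / 4) := by
  simp only [kd, ρH, hmul, hinv, kdPow]
  congr 1
  ring

lemma kd_nonneg (ξ η : H1) : 0 ≤ kd ξ η := by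
  rw [kd_eq_rpow]; exact rpow_nonneg (kdPow_nonneg ξ η) _

lemma kd_pow_four (ξ η : H1) : kd ξ η ^ 4 = kdPow ξ η := by
  rw [kd_eq_rpow, ← rpow_natCast, ← rpow_mul (kdPow_nonneg ξ η)]
  norm_num

@[fun_prop]
lemma contDiff_kdPow (ξ : H1) : ContDiff ℝ (⊤ : ℕ∞) (kdPow ξ) := by
  unfold kdPow; fun_prop

lemma continuous_kd (ξ : H1) : Continuous (kd ξ) := by
  have h : kd ξ = fun η => kdPow ξ η ^ ((1 : ℝ) / 4) := funext (kd_eq_rpow ξ)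
  rw [h]
  exact (contDiff_kdPow ξ).continuous.rpow_const fun _ => Or.inr (by norm_num)

lemma kdPow_pos_of_ne {ξ η : H1} (h : η ≠ ξ) : 0 < kdPow ξ η := by
  refine (kdPow_nonneg ξ η).lt_of_ne' fun h0 => h ?_
  unfold kdPow at h0
  have h1 : (η.1 - ξ.1) ^ 2 + (η.2.1 - ξ.2.1) ^ 2 = 0 := by
    have : ((η.1 - ξ.1) ^ 2 + (η.2.1 - ξ.2.1) ^ 2) ^ 2 = 0 := by
      apply le_antisymm _ (sq_nonneg _)
      nlinarith [sq_nonneg (η.2.2 - ξ.2.2 + 2 * (ξ.1 * η.2.1 - η.1 * ξ.2.1))]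
    exact pow_eq_zero_iff two_ne_zero |>.1 this
  have h2 : η.2.2 - ξ.2.2 + 2 * (ξ.1 * η.2.1 - η.1 * ξ.2.1) = 0 := by
    rw [h1] at h0
    exact pow_eq_zero_iff two_ne_zero |>.1 (by linarith)
  have hx : η.1 = ξ.1 := by nlinarith [sq_nonneg (η.1 - ξ.1), sq_nonneg (η.2.1 - ξ.2.1)]
  have hy : η.2.1 = ξ.2.1 := by nlinarith [sq_nonneg (η.1 - ξ.1), sq_nonneg (η.2.1 - ξ.2.1)]
  have ht : η.2.2 = ξ.2.2 := by rw [hx, hy] at h2; linarith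
  exact Prod.ext hx (Prod.ext hy ht)

lemma kd_pos_of_ne {ξ η : H1} (h : η ≠ ξ) : 0 < kd ξ η := by
  rw [kd_eq_rpow]; exact rpow_pos_of_pos (kdPow_pos_of_ne h) _

/-- Koranyi sublevel sets are star-shaped, in the Euclidean sense, about their centre. -/
lemma starConvex_kdPow_lt (ξ : H1) (a : ℝ) : StarConvex ℝ ξ {η | kdPow ξ η < a} := by
  intro η hη s t hs ht hst
  change kdPow ξ η < a at hη
  change kdPow ξ _ < a
  have hs' : s = 1 - t := by linarith
  have ht1 : t ≤ 1 := by linarith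
  have h2 : t ^ 2 ≤ 1 := pow_le_one₀ ht ht1
  have h4 : t ^ 4 ≤ 1 := pow_le_one₀ ht ht1
  refine lt_of_le_of_lt ?_ hη
  have key : kdPow ξ (s • ξ + t • η) =
      t ^ 4 * ((η.1 - ξ.1) ^ 2 + (η.2.1 - ξ.2.1) ^ 2) ^ 2 +
      t ^ 2 * (η.2.2 - ξ.2.2 + 2 * (ξ.1 * η.2.1 - η.1 * ξ.2.1)) ^ 2 := by
    simp only [kdPow, Prod.fst_add, Prod.snd_add, Prod.smul_fst, Prod.smul_snd, smul_eq_mul, hs']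
    ring
  rw [key, kdPow]
  exact add_le_add (mul_le_of_le_one_left (by positivity) h4)
    (mul_le_of_le_one_left (by positivity) h2)

/-- A Koranyi ball about an interior point which misses the boundary lies in the set. -/
lemma kdPow_lt_subset {Ω : Set H1} (hΩ : IsOpen Ω) {ξ : H1} (hξ : ξ ∈ Ω) {a : ℝ} (ha : 0 < a)
    (hfr : ∀ η ∈ frontier Ω, a ≤ kdPow ξ η) :
    {η | kdPow ξ η < a} ⊆ Ω := by
  have hξa : ξ ∈ {η | kdPow ξ η < a} := by
    change kdPow ξ ξ < a
    simpa [kdPow] using ha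
  have hpre : IsPreconnected {η | kdPow ξ η < a} :=
    ((starConvex_kdPow_lt ξ a).isPathConnected hξa).isConnected.isPreconnected
  refine hpre.subset_left_of_subset_union hΩ isClosed_closure.isOpen_compl
    (disjoint_compl_right.mono_right (compl_subset_compl.2 subset_closure)) ?_ ⟨ξ, hξa, hξ⟩
  intro η hη
  by_cases h : η ∈ closure Ω
  · by_contra hn
    have : η ∈ frontier Ω := by
      rw [hΩ.frontier_eq]
      exact ⟨h, fun h' => hn (Or.inl h')⟩
    exact absurd (hfr η this) (not_le.2 hη)
  · exact Or.inr h

/-- The square of the horizontal gradient of the fourth power of the Koranyi distance. -/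
lemma sq_Xd_add_sq_Yd_comp_kdPow (ξ η : H1) {φ : ℝ → ℝ} {φ' : ℝ}
    (hφ : HasDerivAt φ φ' (kdPow ξ η)) :
    Xd (fun ζ => φ (kdPow ξ ζ)) η ^ 2 + Yd (fun ζ => φ (kdPow ξ ζ)) η ^ 2 =
      16 * φ' ^ 2 * ((η.1 - ξ.1) ^ 2 + (η.2.1 - ξ.2.1) ^ 2) * kdPow ξ η := by
  have hd : HasFDerivAt (fun ζ => φ (kdPow ξ ζ)) (φ' • fderiv ℝ (kdPow ξ) η) η :=
    hφ.comp_hasFDerivAt η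
      (((contDiff_kdPow ξ).differentiable (by simp)).differentiableAt.hasFDerivAt)
  have hline : ∀ v : H1, fderiv ℝ (kdPow ξ) η v = deriv (fun s : ℝ => kdPow ξ (η + s • v)) 0 := by
    intro v
    rw [← lineDeriv, (((contDiff_kdPow ξ).differentiable (by simp)).differentiableAt).lineDeriv_eq_fderiv]
  have hpoly : ∀ p q r w z : ℝ, HasDerivAt
      (fun s : ℝ => ((p + s * q) ^ 2 + (r + s * w) ^ 2) ^ 2 + z)
      (4 * (p ^ 2 + r ^ 2) * (p * q + r * w)) 0 := by
    intro p q r w z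
    have h1 : HasDerivAt (fun s : ℝ => p + s * q) q 0 := by
      simpa using ((hasDerivAt_id (0 : ℝ)).mul_const q).const_add p
    have h2 : HasDerivAt (fun s : ℝ => r + s * w) w 0 := by
      simpa using ((hasDerivAt_id (0 : ℝ)).mul_const w).const_add r
    refine ((((h1.pow 2).add (h2.pow 2)).pow 2).add_const z).congr_deriv ?_
    simp
    ring
  have hsq : ∀ p q : ℝ, HasDerivAt (fun s : ℝ => (p + s * q) ^ 2) (2 * p * q) 0 := by
    intro p q
    have h1 : HasDerivAt (fun s : ℝ => p + s * q) q 0 := by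
      simpa using ((hasDerivAt_id (0 : ℝ)).mul_const q).const_add p
    refine (h1.pow 2).congr_deriv ?_
    simp
  have hX : fderiv ℝ (kdPow ξ) η (1, 0, 2 * η.2.1) =
      4 * ((η.1 - ξ.1) ^ 2 + (η.2.1 - ξ.2.1) ^ 2) * (η.1 - ξ.1) +
      4 * (η.2.2 - ξ.2.2 + 2 * (ξ.1 * η.2.1 - η.1 * ξ.2.1)) * (η.2.1 - ξ.2.1) := by
    rw [hline]
    refine HasDerivAt.deriv ?_
    convert (hpoly (η.1 - ξ.1) 1 (η.2.1 - ξ.2.1) 0 0).add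
      (hsq (η.2.2 - ξ.2.2 + 2 * (ξ.1 * η.2.1 - η.1 * ξ.2.1)) (2 * (η.2.1 - ξ.2.1))) using 1
    · funext s
      simp [kdPow]
      ring
    · ring
  have hY : fderiv ℝ (kdPow ξ) η (0, 1, -2 * η.1) =
      4 * ((η.1 - ξ.1) ^ 2 + (η.2.1 - ξ.2.1) ^ 2) * (η.2.1 - ξ.2.1) -
      4 * (η.2.2 - ξ.2.2 + 2 * (ξ.1 * η.2.1 - η.1 * ξ.2.1)) * (η.1 - ξ.1) := by
    rw [hline]
    refine HasDerivAt.deriv ?_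
    convert (hpoly (η.1 - ξ.1) 0 (η.2.1 - ξ.2.1) 1 0).add
      (hsq (η.2.2 - ξ.2.2 + 2 * (ξ.1 * η.2.1 - η.1 * ξ.2.1)) (-2 * (η.1 - ξ.1))) using 1
    · funext s
      simp [kdPow]
      ring
    · ring
  rw [Xd, Yd, hd.fderiv, smul_apply, smul_apply, hX, hY, kdPow, smul_eq_mul, smul_eq_mul]
  ring

lemma J1_pos {l : ℝ} (h0 : 0 < l) (h1 : l < 2.3) : 0 < J1 l := by
  unfold J1
  refine mul_pos (by positivity) ?_
  set x : ℝ := (l / 2) ^ 2 with hx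
  have hx0 : 0 ≤ x := by positivity
  have hx1 : x / 2 < 0.67 := by rw [hx]; nlinarith
  set a : ℕ → ℝ := fun k =>
    ((-1 : ℝ) ^ k / ((Nat.factorial k : ℝ) * (Nat.factorial (k + 1) : ℝ))) * (l / 2) ^ (2 * k)
    with ha
  have hpow : ∀ k : ℕ, (2 : ℝ) ^ k ≤ (Nat.factorial (k + 1) : ℝ) := fun k => by
    have := Nat.factorial_mul_pow_le_factorial (m := 1) (n := k)
    rw [Nat.factorial_one, one_mul, add_comm 1 k] at this
    exact_mod_cast this
  have hbound : ∀ k, ‖a k‖ ≤ (x / 2) ^ k / (Nat.factorial k : ℝ) := by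
    intro k
    have e : ‖a k‖ = x ^ k / ((Nat.factorial k : ℝ) * (Nat.factorial (k + 1) : ℝ)) := by
      simp only [ha, pow_mul, ← hx]
      rw [norm_mul, norm_div, norm_pow, norm_neg, norm_one, one_pow,
        Real.norm_of_nonneg (by positivity), Real.norm_of_nonneg (by positivity)]
      ring
    rw [e, div_pow, div_div]
    have := hpow k
    have hk : (0 : ℝ) < Nat.factorial k := by positivity
    rw [mul_comm ((2 : ℝ) ^ k)]
    gcongr
  have hs := Real.summable_pow_div_factorial (x / 2)
  have hsa : Summable a := Summable.of_norm_bounded hs hbound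
  have hexp : ∑' k : ℕ, (x / 2) ^ k / (Nat.factorial k : ℝ) = exp (x / 2) := by
    rw [Real.exp_eq_exp_ℝ, NormedSpace.exp_eq_tsum_div]
  have hlt : exp (x / 2) < 2 := by
    rw [← Real.lt_log_iff_exp_lt (by norm_num)]
    linarith [Real.log_two_gt_d9]
  rw [hs.tsum_eq_zero_add] at hexp
  rw [hsa.tsum_eq_zero_add]
  have htail : ‖∑' k, a (k + 1)‖ ≤ ∑' k : ℕ, (x / 2) ^ (k + 1) / (Nat.factorial (k + 1) : ℝ) :=
    tsum_of_norm_bounded ((summable_nat_add_iff 1).2 hs).hasSum fun k => hbound (k + 1)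
  have ha0 : a 0 = 1 := by simp [ha]
  rw [Real.norm_eq_abs] at htail
  have := (abs_le.1 htail).1
  simp at hexp
  linarith

lemma bessel_constant_lower_bound {l : ℝ} (hl : 2.3 ≤ l) :
    80 ≤ 16 * Real.sqrt 2 * Real.sqrt (3 / (2 * π)) * l ^ 2 := by
  have h1 : (1.41 : ℝ) ≤ Real.sqrt 2 := Real.le_sqrt_of_sq_le (by norm_num)
  have h2 : (0.685 : ℝ) ≤ Real.sqrt (3 / (2 * π)) := by
    refine Real.le_sqrt_of_sq_le ?_
    rw [le_div_iff₀ (by positivity)]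
    nlinarith [Real.pi_lt_d2]
  have h3 : (5.29 : ℝ) ≤ l ^ 2 := by nlinarith
  calc (80 : ℝ) ≤ 16 * 1.41 * 0.685 * 5.29 := by norm_num
    _ ≤ _ := by gcongr

/-- The volume of a Koranyi ball is proportional to the fourth power of the radius. -/
lemma volume_kdPow_lt (ξ : H1) {a : ℝ} (ha : 0 < a) :
    volume.real {η | kdPow ξ η < a} = a * volume.real {η | kdPow 0 η < 1} := by
  have hshift : ∀ c : ℝ, Measure.map (fun t : ℝ => t + c) volume = volume := fun c =>
    (measurePreserving_add_right volume c).map_eq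
  have hT : MeasurePreserving (fun η : H1 => (η.1 - ξ.1, η.2.1 - ξ.2.1,
      η.2.2 + (-ξ.2.2 + 2 * (ξ.1 * η.2.1 - η.1 * ξ.2.1)))) volume volume := by
    have hx : MeasurePreserving (fun x : ℝ => x - ξ.1) volume volume :=
      measurePreserving_sub_right volume _
    have hy : MeasurePreserving (fun x : ℝ => x - ξ.2.1) volume volume :=
      measurePreserving_sub_right volume _
    refine hx.skew_product (g := fun x (p : ℝ × ℝ) => (p.1 - ξ.2.1,
      p.2 + (-ξ.2.2 + 2 * (ξ.1 * p.1 - x * ξ.2.1)))) (by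
        simp only [Function.uncurry_def]; fun_prop)
      (Filter.Eventually.of_forall fun x => ?_)
    refine (hy.skew_product (g := fun y t => t + (-ξ.2.2 + 2 * (ξ.1 * y - x * ξ.2.1)))
      (by simp only [Function.uncurry_def]; fun_prop) (Filter.Eventually.of_forall fun y => ?_)).map_eq
    exact hshift _
  have hmeas : ∀ b, MeasurableSet {η : H1 | kdPow 0 η < b} := fun b =>
    (isOpen_lt (contDiff_kdPow 0).continuous continuous_const).measurableSet
  have h1 : volume {η | kdPow ξ η < a} = volume {η : H1 | kdPow 0 η < a} := by
    rw [← hT.measure_preimage (hmeas a).nullMeasurableSet]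
    congr 1
    ext η
    simp [kdPow]
    ring_nf
  set r : ℝ := a ^ ((1 : ℝ) / 4) with hr
  have hr0 : 0 < r := rpow_pos_of_pos ha _
  have hr4 : r ^ 4 = a := by
    rw [hr, ← rpow_natCast, ← rpow_mul ha.le]; norm_num
  let L : H1 →ₗ[ℝ] H1 := LinearMap.prodMap (r⁻¹ • LinearMap.id)
    (LinearMap.prodMap (r⁻¹ • LinearMap.id) ((r⁻¹) ^ 2 • LinearMap.id))
  have hdet : LinearMap.det L = a⁻¹ := by
    simp only [L, LinearMap.det_prodMap, LinearMap.det_smul, LinearMap.det_id, Module.finrank_self]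
    rw [← hr4]
    simp only [pow_one, mul_one, ← inv_pow]
    ring
  have h2 : {η : H1 | kdPow 0 η < a} = L ⁻¹' {η | kdPow 0 η < 1} := by
    ext η
    have : kdPow 0 (L η) = a⁻¹ * kdPow 0 η := by
      simp only [kdPow, L, LinearMap.prodMap_apply, LinearMap.smul_apply, LinearMap.id_apply,
        Prod.fst_zero, Prod.snd_zero, smul_eq_mul, ← hr4]
      field_simp
      ring
    simp only [mem_ofPred_eq, mem_preimage, this]
    rw [inv_mul_lt_iff₀ ha, mul_one]
  have hv : (volume : Measure (ℝ × ℝ)).IsAddHaarMeasure :=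
    inferInstanceAs ((volume : Measure ℝ).prod volume).IsAddHaarMeasure
  have hv' : (volume : Measure H1).IsAddHaarMeasure :=
    inferInstanceAs ((volume : Measure ℝ).prod (volume : Measure (ℝ × ℝ))).IsAddHaarMeasure
  have h3 := Measure.addHaar_preimage_linearMap (volume : Measure H1) (f := L)
    (by rw [hdet]; positivity) {η | kdPow 0 η < 1}
  rw [hdet, inv_inv, abs_of_pos ha] at h3
  rw [measureReal_def, h1, h2, h3, ENNReal.toReal_mul, ENNReal.toReal_ofReal ha.le, measureReal_def]

/-- Along a line in direction `v`, the first derivative of `H` is the directional derivative, and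
so is the second one provided the differentiated direction field is constant on the line. -/
lemma deriv_deriv_line {Ω : Set H1} (hΩ : IsOpen Ω) {H : H1 → ℝ} (hH : ContDiffOn ℝ 2 H Ω)
    {p : H1} (hp : p ∈ Ω) (w : H1 → H1) (hw : ContDiff ℝ 1 w)
    (hline : ∀ s : ℝ, w (p + s • w p) = w p) :
    (∀ᶠ s in nhds (0 : ℝ), HasDerivAt (fun s => H (p + s • w p))
      (fderiv ℝ H (p + s • w p) (w p)) s) ∧
    HasDerivAt (fun s : ℝ => fderiv ℝ H (p + s • w p) (w p))
      (fderiv ℝ (fun η => fderiv ℝ H η (w η)) p (w p)) 0 := by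
  have hl : ∀ s : ℝ, HasDerivAt (fun s : ℝ => p + s • w p) (w p) s := fun s => by
    simpa using ((hasDerivAt_id s).smul_const (w p)).const_add p
  constructor
  · have hc : ContinuousAt (fun s : ℝ => p + s • w p) 0 := (hl 0).continuousAt
    have hmem : ∀ᶠ s in nhds (0 : ℝ), p + s • w p ∈ Ω :=
      hc.eventually (by simpa using hΩ.mem_nhds hp)
    filter_upwards [hmem] with s hs
    have hd : DifferentiableAt ℝ H (p + s • w p) :=
      (hH.contDiffAt (hΩ.mem_nhds hs)).differentiableAt (by norm_num)
    exact hd.hasFDerivAt.comp_hasDerivAt s (hl s)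
  · have hd : DifferentiableAt ℝ (fun η => fderiv ℝ H η (w η)) p := by
      have h1 : DifferentiableAt ℝ (fderiv ℝ H) p :=
        ((hH.contDiffAt (hΩ.mem_nhds hp)).fderiv_right (m := 1) (by norm_num)).differentiableAt
          (by norm_num)
      exact h1.clm_apply (hw.differentiable (by norm_num)).differentiableAt
    have hd' : HasFDerivAt (fun η => fderiv ℝ H η (w η))
        (fderiv ℝ (fun η => fderiv ℝ H η (w η)) p) (p + (0 : ℝ) • w p) := by
      simpa using hd.hasFDerivAt
    have := hd'.comp_hasDerivAt (0 : ℝ) (hl 0)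
    simpa [Function.comp_def, hline] using this

lemma IsLocalMin.nonneg_of_hasDerivAt_deriv {f f' : ℝ → ℝ} {x c : ℝ} (h : IsLocalMin f x)
    (hf : ∀ᶠ s in nhds x, HasDerivAt f (f' s) s) (hf' : HasDerivAt f' c x) : 0 ≤ c := by
  have he : deriv f =ᶠ[nhds x] f' := hf.mono fun s hs => hs.deriv
  have hdd : deriv (deriv f) x = c := by rw [he.deriv_eq, hf'.deriv]
  by_contra! hneg
  have hmax := isLocalMax_of_deriv_deriv_neg (by rw [hdd]; exact hneg) h.deriv_eq_zero
    hf.self_of_nhds.continuousAt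
  have hconst : f =ᶠ[nhds x] fun _ => f x := by
    filter_upwards [h, hmax] with s h1 h2
    exact le_antisymm h2 h1
  have h0 : deriv f =ᶠ[nhds x] fun _ => 0 := by simpa using hconst.deriv
  rw [h0.deriv_eq, deriv_const] at hdd
  exact hneg.ne hdd.symm

/-- The weak minimum principle for functions harmonic for the Kohn Laplacian. -/
lemma le_of_kohn_eq_zero {Ω : Set H1} (hΩ : IsOpen Ω) (hb : Bornology.IsBounded Ω) {H : H1 → ℝ}
    (hc : ContinuousOn H (closure Ω)) (hH : ContDiffOn ℝ 2 H Ω) (hk : ∀ η ∈ Ω, kohn H η = 0)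
    {c : ℝ} (hfr : ∀ η ∈ frontier Ω, c ≤ H η) {ξ : H1} (hξ : ξ ∈ Ω) : c ≤ H ξ := by
  have hcomp : IsCompact (closure Ω) := hb.isCompact_closure
  obtain ⟨R, hR⟩ := hcomp.exists_bound_of_continuousOn
    (f := fun η : H1 => η.1 ^ 2) (by fun_prop)
  have hR' : ∀ η ∈ closure Ω, η.1 ^ 2 ≤ R := fun η hη => (le_abs_self _).trans (hR η hη)
  refine le_of_forall_pos_sub_le fun δ hδ => ?_
  have hR0 : 0 ≤ R := (sq_nonneg _).trans (hR' ξ (subset_closure hξ))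
  set ε : ℝ := δ / (R + 1) with hε
  have hε0 : 0 < ε := by positivity
  have hεR : ε * R ≤ δ := by
    rw [hε, div_mul_eq_mul_div, div_le_iff₀ (by positivity)]
    nlinarith
  obtain ⟨p, hp, hmin⟩ := hcomp.exists_isMinOn ⟨ξ, subset_closure hξ⟩
    (f := fun η => H η - ε * η.1 ^ 2) (hc.sub (by fun_prop))
  have hξmin : H p - ε * p.1 ^ 2 ≤ H ξ - ε * ξ.1 ^ 2 := hmin (subset_closure hξ)
  by_cases hpΩ : p ∈ Ω
  · exfalso
    have hloc : IsLocalMin (fun η => H η - ε * η.1 ^ 2) p :=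
      (hmin.on_subset subset_closure).isLocalMin (hΩ.mem_nhds hpΩ)
    have hcurve : ∀ v : H1, IsLocalMin (fun s : ℝ => H (p + s • v) - ε * (p + s • v).1 ^ 2) 0 := by
      intro v
      have hcont : ContinuousAt (fun s : ℝ => p + s • v) 0 := by fun_prop
      have hloc' : ∀ᶠ η in nhds (p + (0 : ℝ) • v),
          H p - ε * p.1 ^ 2 ≤ H η - ε * η.1 ^ 2 := by
        rw [zero_smul, add_zero]
        exact hloc
      filter_upwards [hcont.eventually hloc'] with s hs
      simpa using hs
    obtain ⟨hX1, hX2⟩ := deriv_deriv_line hΩ hH hpΩ (fun η => (1, 0, 2 * η.2.1)) (by fun_prop)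
      (by simp)
    obtain ⟨hY1, hY2⟩ := deriv_deriv_line hΩ hH hpΩ (fun η => (0, 1, -2 * η.1)) (by fun_prop)
      (by simp)
    have hl : ∀ s : ℝ, HasDerivAt (fun s : ℝ => p.1 + s) 1 s := fun s =>
      (hasDerivAt_id s).const_add p.1
    have hXX : 0 ≤ Xd (Xd H) p - 2 * ε := by
      have hmin' := hcurve (1, 0, 2 * p.2.1)
      simp only [Prod.fst_add, Prod.smul_fst, smul_eq_mul, mul_one] at hmin'
      refine hmin'.nonneg_of_hasDerivAt_deriv
        (f' := fun s => fderiv ℝ H (p + s • (1, 0, 2 * p.2.1)) (1, 0, 2 * p.2.1) -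
          2 * ε * (p.1 + s)) ?_ ?_
      · filter_upwards [hX1] with s hs
        refine (hs.sub (((hl s).pow 2).const_mul ε)).congr_deriv ?_
        simp
        ring
      · refine (hX2.sub ((hl 0).const_mul (2 * ε))).congr_deriv ?_
        simp only [mul_one]
        rfl
    have hYY : 0 ≤ Yd (Yd H) p := by
      have hmin' := hcurve (0, 1, -2 * p.1)
      simp only [Prod.fst_add, Prod.smul_fst, smul_eq_mul, mul_zero, add_zero] at hmin'
      refine hmin'.nonneg_of_hasDerivAt_deriv
        (f' := fun s => fderiv ℝ H (p + s • (0, 1, -2 * p.1)) (0, 1, -2 * p.1)) ?_ hY2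
      filter_upwards [hY1] with s hs
      simpa using hs.sub_const (ε * p.1 ^ 2)
    have := hk p hpΩ
    unfold kohn at this
    linarith
  · have hpf : p ∈ frontier Ω := by
      rw [hΩ.frontier_eq]; exact ⟨hp, hpΩ⟩
    have h1 := hfr p hpf
    have h2 := mul_le_mul_of_nonneg_left (hR' p hp) hε0.le
    have h3 := mul_nonneg hε0.le (sq_nonneg ξ.1)
    linarith

/-- A smooth transition from `1` to `0` on `[0.51, 0.99]` with nearly optimal slope. -/
lemma exists_steep_cutoff : ∃ φ g : ℝ → ℝ, ContDiff ℝ (⊤ : ℕ∞) φ ∧ (∀ x, HasDerivAt φ (g x) x) ∧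
    (∀ x ≤ 0.51, φ x = 1) ∧ (∀ x, 0.99 ≤ x → φ x = 0) ∧ (∀ x, g x ^ 2 ≤ 4.73) ∧
    (∀ x ≤ 0.51, g x = 0) ∧ (∀ x, 0.99 ≤ x → g x = 0) := by
  let b : ContDiffBump (0.75 : ℝ) := ⟨0.23, 0.24, by norm_num, by norm_num⟩
  set u : ℝ → ℝ := b.normed volume with hu
  have hcu : Continuous u := b.continuous_normed
  have hsupp : Function.support u = Metric.ball 0.75 0.24 := b.support_normed_eq
  have hlow : ∀ x ≤ 0.51, u x = 0 := by
    intro x hx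
    rw [← Function.notMem_support, hsupp, Metric.mem_ball, Real.dist_eq, not_lt, abs_sub_comm]
    exact le_trans (by norm_num at hx ⊢; linarith) (le_abs_self _)
  have hhigh : ∀ x, 0.99 ≤ x → u x = 0 := by
    intro x hx
    rw [← Function.notMem_support, hsupp, Metric.mem_ball, Real.dist_eq, not_lt]
    exact le_trans (by norm_num at hx ⊢; linarith) (le_abs_self _)
  have hder : ∀ x, HasDerivAt (fun x => 1 - ∫ s in (0 : ℝ)..x, u s) (-u x) x := fun x =>
    (intervalIntegral.integral_hasDerivAt_right (hcu.intervalIntegrable _ _)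
      (hcu.stronglyMeasurableAtFilter _ _) hcu.continuousAt).const_sub 1
  refine ⟨fun x => 1 - ∫ s in (0 : ℝ)..x, u s, fun x => -u x, ?_, hder, ?_, ?_, ?_, ?_, ?_⟩
  · refine contDiff_infty_iff_deriv.2 ⟨fun x => (hder x).differentiableAt, ?_⟩
    rw [funext fun x => (hder x).deriv]
    exact b.contDiff_normed.neg
  · intro x hx
    have : ∫ s in (0 : ℝ)..x, u s = 0 := by
      refine intervalIntegral.integral_zero_ae (Filter.Eventually.of_forall fun s hs => hlow s ?_)
      exact hs.2.trans (max_le (by norm_num) hx)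
    simp [this]
  · intro x hx
    have : ∫ s in (0 : ℝ)..x, u s = 1 := by
      rw [intervalIntegral.integral_eq_integral_of_support_subset, hu, b.integral_normed]
      rw [hsupp, Real.ball_eq_Ioo]
      intro s hs
      norm_num at hs hx
      exact ⟨by linarith [hs.1], by linarith [hs.2]⟩
    simp [this]
  · intro x
    have h0 : 0 ≤ u x := b.nonneg_normed x
    have h1 : u x ≤ 1 / 0.46 := by
      refine (b.normed_le_div_measure_closedBall_rIn volume x).trans_eq ?_
      rw [measureReal_def, Real.volume_closedBall, ENNReal.toReal_ofReal (by positivity)]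
      norm_num [b]
    calc (-u x) ^ 2 = u x ^ 2 := by ring
      _ ≤ (1 / 0.46) ^ 2 := by gcongr
      _ ≤ _ := by norm_num
  · intro x hx; simp [hlow x hx]
  · intro x hx; simp [hhigh x hx]

lemma lam1_le_div {Ω : Set H1} {v : H1 → ℝ} (hv : ContDiff ℝ (⊤ : ℕ∞) v)
    (hc : HasCompactSupport v) (hs : tsupport v ⊆ Ω) (h0 : v ≠ 0) :
    lam1 Ω ≤ (∫ η in Ω, ((Xd v η) ^ 2 + (Yd v η) ^ 2)) / (∫ η in Ω, (v η) ^ 2) := by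
  refine csInf_le ⟨0, ?_⟩ ⟨v, hv, hc, hs, h0, rfl⟩
  rintro _ ⟨w, -, -, -, -, rfl⟩
  exact div_nonneg (integral_nonneg fun η => by positivity) (integral_nonneg fun η => by positivity)

/-- A domain whose boundary is at Koranyi distance at least `m` from one of its points has first
eigenvalue at most `72 / m ^ 2`. -/
lemma lam1_le {Ω : Set H1} (hΩ : IsOpen Ω) (hb : Bornology.IsBounded Ω) {ξ : H1} (hξ : ξ ∈ Ω)
    {m : ℝ} (hm : 0 < m) (hfr : ∀ η ∈ frontier Ω, m ^ 4 ≤ kdPow ξ η) :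
    lam1 Ω ≤ 72 / m ^ 2 := by
  obtain ⟨φ, g, hφ, hg, hφ1, hφ0, hg2, hgl, hgr⟩ := exists_steep_cutoff
  set M : ℝ := m ^ 4 with hM
  have hM0 : 0 < M := by positivity
  have hsub : {η | kdPow ξ η < M} ⊆ Ω := kdPow_lt_subset hΩ hξ hM0 hfr
  have hcN : Continuous (kdPow ξ) := (contDiff_kdPow ξ).continuous
  set v : H1 → ℝ := fun η => φ (kdPow ξ η / M) with hv
  have hvs : ContDiff ℝ (⊤ : ℕ∞) v := hφ.comp ((contDiff_kdPow ξ).div_const M)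
  have hcomp : IsCompact (closure Ω) := hb.isCompact_closure
  have htsupp : tsupport v ⊆ Ω := by
    have hcl : IsClosed {η | kdPow ξ η ≤ 0.99 * M} := isClosed_le hcN continuous_const
    refine (closure_minimal (fun η hη => ?_) hcl).trans
      (Subset.trans (fun η hη => ?_) hsub)
    · by_contra h
      change ¬ kdPow ξ η ≤ 0.99 * M at h
      exact hη (hφ0 _ ((le_div_iff₀ hM0).2 (not_le.1 h).le))
    · change kdPow ξ η ≤ 0.99 * M at hη
      change kdPow ξ η < M
      linarith
  have hcs : HasCompactSupport v :=
    hcomp.of_isClosed_subset (isClosed_tsupport v) (htsupp.trans subset_closure)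
  have hvξ : v ξ = 1 := hφ1 _ (by norm_num [kdPow])
  have hvne : v ≠ 0 := fun h => by simp [h] at hvξ
  refine (lam1_le_div hvs hcs htsupp hvne).trans ?_
  have hfin : volume Ω ≠ ⊤ := hb.measure_lt_top.ne
  set K : ℝ := volume.real {η | kdPow 0 η < 1} with hK
  set E : Set H1 := {η | kdPow ξ η < 0.51 * M} with hE
  set F : Set H1 := {η | kdPow ξ η < 0.99 * M} with hF
  have hEF : E ⊆ F := fun η hη => by
    change kdPow ξ η < 0.51 * M at hη
    change kdPow ξ η < 0.99 * M
    linarith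
  have hFΩ : F ⊆ Ω := Subset.trans (fun η hη => by
    change kdPow ξ η < 0.99 * M at hη
    change kdPow ξ η < M
    linarith) hsub
  have hEo : IsOpen E := isOpen_lt hcN continuous_const
  have hFo : IsOpen F := isOpen_lt hcN continuous_const
  have hEfin : volume E ≠ ⊤ := measure_ne_top_of_subset (hEF.trans hFΩ) hfin
  have hEK : volume.real E = 0.51 * M * K := volume_kdPow_lt ξ (by positivity)
  have hFK : volume.real F = 0.99 * M * K := volume_kdPow_lt ξ (by positivity)
  have hEpos : 0 < volume.real E := by
    refine ENNReal.toReal_pos (hEo.measure_pos volume ⟨ξ, ?_⟩).ne' hEfin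
    change kdPow ξ ξ < 0.51 * M
    have h0 : kdPow ξ ξ = 0 := by simp [kdPow]
    rw [h0]
    positivity
  have hK0 : 0 < K := by
    rw [hEK] at hEpos
    exact pos_of_mul_pos_right hEpos (by positivity)
  have hden : 0.51 * M * K ≤ ∫ η in Ω, v η ^ 2 := by
    have hint : IntegrableOn (fun η => v η ^ 2) Ω :=
      ((hvs.continuous.pow 2).continuousOn.integrableOn_compact hcomp).mono_set subset_closure
    calc 0.51 * M * K = ∫ η in E, (1 : ℝ) := by simp [hEK]
      _ = ∫ η in E, v η ^ 2 := by
        refine setIntegral_congr_fun hEo.measurableSet fun η hη => ?_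
        change kdPow ξ η < 0.51 * M at hη
        have : v η = 1 := hφ1 _ ((div_le_iff₀ hM0).2 hη.le)
        simp [this]
      _ ≤ _ := setIntegral_mono_set hint (Filter.Eventually.of_forall fun η => sq_nonneg _)
        (hEF.trans hFΩ).eventuallyLE
  have hpt : ∀ η, Xd v η ^ 2 + Yd v η ^ 2 ≤ (F \ E).indicator (fun _ => 16 * 4.73 / m ^ 2) η := by
    intro η
    have hd : HasDerivAt (fun n => φ (n / M)) (g (kdPow ξ η / M) / M) (kdPow ξ η) := by
      have := (hg (kdPow ξ η / M)).comp (kdPow ξ η) ((hasDerivAt_id (kdPow ξ η)).div_const M)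
      refine this.congr_deriv ?_
      ring
    rw [hv, sq_Xd_add_sq_Yd_comp_kdPow ξ η hd]
    by_cases hη : η ∈ F \ E
    · rw [indicator_of_mem hη]
      have hN : kdPow ξ η ≤ M := by
        have : kdPow ξ η < 0.99 * M := hη.1
        linarith
      have hs : (η.1 - ξ.1) ^ 2 + (η.2.1 - ξ.2.1) ^ 2 ≤ m ^ 2 := by
        refine le_of_sq_le_sq ?_ (by positivity)
        calc _ ≤ kdPow ξ η := le_add_of_nonneg_right (sq_nonneg _)
          _ ≤ (m ^ 2) ^ 2 := hN.trans_eq (by rw [hM]; ring)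
      calc 16 * (g (kdPow ξ η / M) / M) ^ 2 * ((η.1 - ξ.1) ^ 2 + (η.2.1 - ξ.2.1) ^ 2) * kdPow ξ η
          ≤ 16 * (4.73 / M ^ 2) * m ^ 2 * M := by
            rw [div_pow]
            have := hg2 (kdPow ξ η / M)
            have := kdPow_nonneg ξ η
            gcongr
        _ = 16 * 4.73 / m ^ 2 := by
            rw [hM]
            field_simp
    · rw [indicator_of_notMem hη]
      have hg0 : g (kdPow ξ η / M) = 0 := by
        by_cases hηE : η ∈ E
        · have : kdPow ξ η < 0.51 * M := hηE
          exact hgl _ ((div_le_iff₀ hM0).2 this.le)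
        · have : ¬ kdPow ξ η < 0.99 * M := fun h => hη ⟨h, hηE⟩
          exact hgr _ ((le_div_iff₀ hM0).2 (not_lt.1 this))
      simp [hg0]
  have hmeas : MeasurableSet (F \ E) := hFo.measurableSet.diff hEo.measurableSet
  have hnum : ∫ η in Ω, (Xd v η ^ 2 + Yd v η ^ 2) ≤ 0.48 * M * K * (16 * 4.73 / m ^ 2) := by
    calc ∫ η in Ω, (Xd v η ^ 2 + Yd v η ^ 2)
        ≤ ∫ η in Ω, (F \ E).indicator (fun _ => 16 * 4.73 / m ^ 2) η := by
          refine integral_mono_of_nonneg (Filter.Eventually.of_forall fun η => by positivity) ?_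
            (Filter.Eventually.of_forall hpt)
          exact (integrableOn_const hfin).indicator hmeas
      _ = volume.real (F \ E) * (16 * 4.73 / m ^ 2) := by
          rw [setIntegral_indicator hmeas, inter_eq_right.2 (sdiff_subset.trans hFΩ)]
          simp
      _ = _ := by
          rw [measureReal_sdiff hEF hEo.measurableSet
            (measure_ne_top_of_subset hFΩ hfin), hEK, hFK]
          ring
  have hD : 0 < 0.51 * M * K := by positivity
  rw [div_le_iff₀ (hD.trans_le hden)]
  calc _ ≤ 0.48 * M * K * (16 * 4.73 / m ^ 2) := hnum
    _ ≤ 72 / m ^ 2 * (0.51 * M * K) := by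
      have : 0 ≤ M * K / m ^ 2 := by positivity
      have e1 : 0.48 * M * K * (16 * 4.73 / m ^ 2) = 36.3264 * (M * K / m ^ 2) := by ring
      have e2 : 72 / m ^ 2 * (0.51 * M * K) = 36.72 * (M * K / m ^ 2) := by ring
      rw [e1, e2]
      gcongr
      norm_num
    _ ≤ _ := by gcongr

/-- Refined main theorem: if ξ₀ is a harmonic center of Ω, then
λ₁(Ω) ≤ C_Ω(ξ₀)·l₁₁²/(max_{ξ∈Ω} r_Ω(ξ))², where
C_Ω(ξ₀) = 16√2·α_Ω(ξ₀)⁶·√(3/(2π)). -/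
theorem first_eigenvalue_upper_bound_center (Ω : Set H1) (hΩo : IsOpen Ω)
    (hΩb : Bornology.IsBounded Ω) (hsm : smoothBdry Ω)
    (hu1 : uebp Ω) (hu2 : uebp (Set.univ \ closure Ω))
    (Hf : H1 → H1 → ℝ)
    (hreg : ∀ ξ ∈ Ω, ContinuousOn (Hf ξ) (closure Ω) ∧ ContDiffOn ℝ 2 (Hf ξ) Ω ∧
      (∀ η ∈ Ω, kohn (Hf ξ) η = 0) ∧ (∀ η ∈ frontier Ω, Hf ξ η = Γξ ξ η) ∧
      0 < Hf ξ ξ)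
    (ξ₀ : H1) (hξ₀ : ξ₀ ∈ Ω)
    (hcenter : ∀ ξ ∈ Ω,
      1 / Real.sqrt (8 * π * Hf ξ ξ) ≤ 1 / Real.sqrt (8 * π * Hf ξ₀ ξ₀))
    (l11 : ℝ) (hl11pos : 0 < l11) (hl11zero : J1 l11 = 0)
    (hl11min : ∀ l : ℝ, 0 < l → J1 l = 0 → l11 ≤ l) :
    let rmax : ℝ := 1 / Real.sqrt (8 * π * Hf ξ₀ ξ₀)
    let α : ℝ := sSup (kd ξ₀ '' frontier Ω) / sInf (kd ξ₀ '' frontier Ω)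
    lam1 Ω ≤ (16 * Real.sqrt 2 * α ^ 6 * Real.sqrt (3 / (2 * π))) * l11 ^ 2 / rmax ^ 2 := by
  intro rmax α
  have hπ := Real.pi_pos
  have hHpos : 0 < Hf ξ₀ ξ₀ := (hreg ξ₀ hξ₀).2.2.2.2
  have hne : (frontier Ω).Nonempty := by
    refine nonempty_frontier_iff.2 ⟨⟨ξ₀, hξ₀⟩, fun h => ?_⟩
    exact NormedSpace.unbounded_univ ℝ H1 (h ▸ hΩb)
  have hcomp : IsCompact (frontier Ω) :=
    hΩb.isCompact_closure.of_isClosed_subset isClosed_frontier frontier_subset_closure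
  have himg : IsCompact (kd ξ₀ '' frontier Ω) := hcomp.image (continuous_kd ξ₀)
  have himgne : (kd ξ₀ '' frontier Ω).Nonempty := hne.image _
  have hkpos : ∀ η ∈ frontier Ω, 0 < kd ξ₀ η := by
    intro η hη
    refine kd_pos_of_ne fun h => ?_
    rw [hΩo.frontier_eq] at hη
    exact hη.2 (h ▸ hξ₀)
  set R := sSup (kd ξ₀ '' frontier Ω) with hR
  set m := sInf (kd ξ₀ '' frontier Ω) with hm
  have hkm : ∀ η ∈ frontier Ω, m ≤ kd ξ₀ η := fun η hη =>
    csInf_le himg.bddBelow (mem_image_of_mem _ hη)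
  have hkR : ∀ η ∈ frontier Ω, kd ξ₀ η ≤ R := fun η hη =>
    le_csSup himg.bddAbove (mem_image_of_mem _ hη)
  have hm0 : 0 < m := by
    obtain ⟨η, hη, h⟩ := himg.sInf_mem himgne
    rw [hm, ← h]
    exact hkpos η hη
  have hmR : m ≤ R := by
    obtain ⟨η, hη⟩ := hne
    exact (hkm η hη).trans (hkR η hη)
  have hR0 : 0 < R := hm0.trans_le hmR
  have hlam : lam1 Ω ≤ 72 / m ^ 2 := by
    refine lam1_le hΩo hΩb hξ₀ hm0 fun η hη => ?_
    rw [← kd_pow_four]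
    exact pow_le_pow_left₀ hm0.le (hkm η hη) 4
  have hH : 1 / (8 * π * R ^ 2) ≤ Hf ξ₀ ξ₀ := by
    obtain ⟨hc, hC2, hk, hb, -⟩ := hreg ξ₀ hξ₀
    refine le_of_kohn_eq_zero hΩo hΩb hc hC2 hk (fun η hη => ?_) hξ₀
    have h1 := hkpos η hη
    have h2 := hkR η hη
    rw [hb η hη, Γξ]
    gcongr
  have hr : 1 / R ^ 2 ≤ 1 / rmax ^ 2 := by
    have : 1 / rmax ^ 2 = 8 * π * Hf ξ₀ ξ₀ := by
      change 1 / (1 / Real.sqrt (8 * π * Hf ξ₀ ξ₀)) ^ 2 = _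
      rw [div_pow, one_pow, one_div_one_div, Real.sq_sqrt (by positivity)]
    rw [this]
    calc 1 / R ^ 2 = 8 * π * (1 / (8 * π * R ^ 2)) := by field_simp
      _ ≤ _ := by gcongr
  have hl : 2.3 ≤ l11 := by
    by_contra! h
    exact (J1_pos hl11pos h).ne' hl11zero
  have hα : 1 ≤ α := (one_le_div hm0).2 hmR
  calc lam1 Ω ≤ 72 / m ^ 2 := hlam
    _ ≤ 80 / m ^ 2 := by gcongr; norm_num
    _ = 80 * α ^ 2 * (1 / R ^ 2) := by
      change 80 / m ^ 2 = 80 * (R / m) ^ 2 * (1 / R ^ 2)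
      field_simp
    _ ≤ (16 * Real.sqrt 2 * Real.sqrt (3 / (2 * π)) * l11 ^ 2) * α ^ 6 * (1 / rmax ^ 2) := by
      have h1 := bessel_constant_lower_bound hl
      have h2 : α ^ 2 ≤ α ^ 6 := pow_le_pow_right₀ hα (by norm_num)
      gcongr
    _ = _ := by ring
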